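/- arXiv:1108.1505 — 2 statements merged into one kernel-verified Lean document; each statement's English description precedes it below -/
import Mathlib

section
/- Let X be an absolutely continuous real random variable with cumulative distribution function F. Then the conditional variance Var(X | 0 ≤ X ≤ b) is an increasing function of b > 0 (over b with P(0 ≤ X ≤ b) > 0) if and only if the function b ↦ ∫∫_{0 ≤ x ≤ y ≤ b} (F(x) − F(0)) dx dy is log-concave in b. -/
open MeasureTheory ProbabilityTheory Set

/-- upper comparison -/
theorem aux_first (g h p q : ℝ) (hp : 0 < p) (hq : 0 < q) :
    (2 * g / q - (h / q) ^ 2) - (2 * g / p - (h / p) ^ 2)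
      = (q - p) / (p * q) * (h ^ 2 * (1 / p + 1 / q) - 2 * g) := by
  field_simp
  ring

theorem aux_abstract (m H G : ℝ → ℝ) (hmc : Continuous m) (hmm : Monotone m) (hm0 : m 0 = 0)
    (hH : ∀ x, HasDerivAt H (m x) x) (hG : ∀ x, HasDerivAt G (H x) x)
    (hH0 : H 0 = 0) (hG0 : G 0 = 0) :
    MonotoneOn (fun b => 2 * G b / m b - (H b / m b) ^ 2) {b : ℝ | 0 < b ∧ 0 < m b} ↔
      ConcaveOn ℝ {b : ℝ | 0 < b ∧ 0 < m b} (fun b => Real.log (G b)) := by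
  have hHc : Continuous H := continuous_iff_continuousAt.2 fun x => (hH x).continuousAt
  have hGc : Continuous G := continuous_iff_continuousAt.2 fun x => (hG x).continuousAt
  set S : Set ℝ := {b : ℝ | 0 < b ∧ 0 < m b} with hS
  have hSo : IsOpen S := (isOpen_lt continuous_const continuous_id).inter
    (isOpen_lt continuous_const hmc)
  have hSup : ∀ u ∈ S, ∀ v, u ≤ v → v ∈ S := fun u hu v huv =>
    ⟨hu.1.trans_le huv, hu.2.trans_le (hmm huv)⟩
  have hSconv : Convex ℝ S := by
    apply OrdConnected.convex
    exact ⟨fun x hx y hy z hz => hSup x hx z hz.1⟩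
  have hmn : ∀ x, 0 ≤ x → 0 ≤ m x := fun x hx => hm0 ▸ hmm hx
  have hHmono : MonotoneOn H (Ici 0) := by
    apply monotoneOn_of_deriv_nonneg (convex_Ici 0) hHc.continuousOn
      (fun x _ => (hH x).differentiableAt.differentiableWithinAt)
    intro x hx
    rw [interior_Ici] at hx
    rw [(hH x).deriv]; exact hmn x (le_of_lt hx)
  have hHn : ∀ x, 0 ≤ x → 0 ≤ H x := fun x hx => by
    have := hHmono (self_mem_Ici) hx hx
    rwa [hH0] at this
  have hGmono : MonotoneOn G (Ici 0) := by
    apply monotoneOn_of_deriv_nonneg (convex_Ici 0) hGc.continuousOn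
      (fun x _ => (hG x).differentiableAt.differentiableWithinAt)
    intro x hx
    rw [interior_Ici] at hx
    rw [(hG x).deriv]; exact hHn x (le_of_lt hx)
  have hGn : ∀ x, 0 ≤ x → 0 ≤ G x := fun x hx => by
    have := hGmono (self_mem_Ici) hx hx
    rwa [hG0] at this
  -- positivity on S
  have hleft : ∀ x ∈ S, ∃ y ∈ S, y < x := by
    intro x hx
    obtain ⟨e, he, hb⟩ := Metric.isOpen_iff.1 hSo x hx
    refine ⟨x - e / 2, hb ?_, by linarith⟩
    rw [Metric.mem_ball, Real.dist_eq, abs_lt]; constructor <;> linarith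
  have hHp : ∀ x ∈ S, 0 < H x := by
    intro x hx
    obtain ⟨y, hy, hyx⟩ := hleft x hx
    have hst : StrictMonoOn H (Ici y) := by
      apply strictMonoOn_of_deriv_pos (convex_Ici y) hHc.continuousOn
      intro z hz
      rw [interior_Ici] at hz
      rw [(hH z).deriv]; exact (hSup y hy z (le_of_lt hz)).2
    exact (hHn y hy.1.le).trans_lt (hst self_mem_Ici hyx.le hyx)
  have hGp : ∀ x ∈ S, 0 < G x := by
    intro x hx
    obtain ⟨y, hy, hyx⟩ := hleft x hx
    have hst : StrictMonoOn G (Ici y) := by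
      apply strictMonoOn_of_deriv_pos (convex_Ici y) hGc.continuousOn
      intro z hz
      rw [interior_Ici] at hz
      rw [(hG z).deriv]; exact hHp z (hSup y hy z (le_of_lt hz))
    exact (hGn y hy.1.le).trans_lt (hst self_mem_Ici hyx.le hyx)
  -- log-concavity iff W ≥ 0
  have hd1 : ∀ x ∈ S, HasDerivAt (fun b => Real.log (G b)) (H x / G x) x := fun x hx =>
    (hG x).log (hGp x hx).ne'
  have hd2 : ∀ x ∈ S, HasDerivAt (fun b => H b / G b) ((m x * G x - H x * H x) / G x ^ 2) x :=
    fun x hx => (hH x).div (hG x) (hGp x hx).ne'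
  have key1 : ConcaveOn ℝ S (fun b => Real.log (G b)) ↔ ∀ x ∈ S, m x * G x ≤ H x * H x := by
    constructor
    · intro hc x hx
      have hanti := hc.antitoneOn_deriv (fun x hx => (hd1 x hx).differentiableAt)
      have hanti2 : AntitoneOn (fun b => H b / G b) S := by
        intro u hu v hv huv
        have := hanti hu hv huv
        rwa [(hd1 u hu).deriv, (hd1 v hv).deriv] at this
      have h1 := hanti2.derivWithin_nonpos (x := x)
      rw [derivWithin_of_isOpen hSo hx, (hd2 x hx).deriv] at h1
      have h2 := pow_pos (hGp x hx) 2
      by_contra hcon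
      push Not at hcon
      have := div_pos (sub_pos.2 hcon) h2
      linarith
    · intro hW
      apply AntitoneOn.concaveOn_of_deriv hSconv
      · exact fun x hx => (hd1 x hx).continuousAt.continuousWithinAt
      · rw [hSo.interior_eq]
        exact fun x hx => (hd1 x hx).differentiableAt.differentiableWithinAt
      · rw [hSo.interior_eq]
        have : AntitoneOn (fun b => H b / G b) S := by
          apply antitoneOn_of_deriv_nonpos hSconv
          · exact fun x hx => (hd2 x hx).continuousAt.continuousWithinAt
          · rw [hSo.interior_eq]
            exact fun x hx => (hd2 x hx).differentiableAt.differentiableWithinAt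
          · rw [hSo.interior_eq]
            intro x hx
            rw [(hd2 x hx).deriv]
            exact div_nonpos_of_nonpos_of_nonneg (sub_nonpos.2 (hW x hx)) (sq_nonneg _)
        intro u hu v hv huv
        rw [(hd1 u hu).deriv, (hd1 v hv).deriv]
        exact this hu hv huv
  rw [key1]
  set V : ℝ → ℝ := fun b => 2 * G b / m b - (H b / m b) ^ 2 with hV
  constructor
  · -- V monotone implies W ≥ 0
    intro hmono
    -- second part nonpositive
    have hpsi : ∀ u ∈ S, ∀ v, u ≤ v →
        2 * G v / m u - (H v / m u) ^ 2 ≤ 2 * G u / m u - (H u / m u) ^ 2 := by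
      intro u hu v huv
      have hder : ∀ x, HasDerivAt (fun b => 2 * G b / m u - (H b / m u) ^ 2)
          (2 * H x / m u - 2 * (H x / m u) * (m x / m u)) x := by
        intro x
        have h1 := ((hG x).const_mul 2).div_const (m u)
        have h2 := ((hH x).div_const (m u)).pow 2
        have h3 := h1.sub h2
        refine h3.congr_deriv ?_
        norm_num
      have : AntitoneOn (fun b => 2 * G b / m u - (H b / m u) ^ 2) (Ici u) := by
        apply antitoneOn_of_deriv_nonpos (convex_Ici u)
        · exact fun x _ => (hder x).continuousAt.continuousWithinAt
        · exact fun x _ => (hder x).differentiableAt.differentiableWithinAt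
        · intro x hx
          rw [interior_Ici] at hx
          rw [(hder x).deriv]
          have h1 : 1 ≤ m x / m u := (one_le_div hu.2).2 (hmm (le_of_lt hx))
          have h2 : 0 ≤ H x / m u := div_nonneg (hHn x (hu.1.le.trans (le_of_lt hx))) hu.2.le
          have h3 : 2 * H x / m u = 2 * (H x / m u) := by ring
          rw [h3]; nlinarith
      exact this self_mem_Ici huv huv
    have hconst : ∀ x, 0 < x → H x * H x < m x * G x → ∀ᶠ y in nhds x, m y = m x := by
      intro x hx0 hx
      have hmx : 0 < m x := by
        rcases (hmn x hx0.le).eq_or_lt with h | h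
        · rw [← h] at hx; nlinarith [mul_self_nonneg (H x)]
        · exact h
      have hxS : x ∈ S := ⟨hx0, hmx⟩
      have hop : IsOpen {p : ℝ × ℝ | H p.1 * H p.1 < m p.2 * G p.1} :=
        isOpen_lt (by fun_prop) (by fun_prop)
      have hmem : {p : ℝ × ℝ | H p.1 * H p.1 < m p.2 * G p.1} ∈ nhds (x, x) := hop.mem_nhds hx
      rw [nhds_prod_eq] at hmem
      obtain ⟨t, ht, hts⟩ := Filter.mem_prod_same_iff.1 hmem
      have key : ∀ u ∈ S, ∀ v ∈ S, u ∈ t → v ∈ t → u ≤ v → m u = m v := by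
        intro u hu v hv hut hvt huv
        by_contra hne
        have hlt : m u < m v := lt_of_le_of_ne (hmm huv) hne
        have hW : H v * H v < m u * G v := hts (show (v, u) ∈ t ×ˢ t from ⟨hvt, hut⟩)
        have h1 := hpsi u hu v huv
        have h2 := hmono hu hv huv
        simp only [hV] at h2
        have h3 := aux_first (G v) (H v) (m u) (m v) hu.2 hv.2
        have h4 : 0 < (m v - m u) / (m u * m v) := div_pos (sub_pos.2 hlt) (mul_pos hu.2 hv.2)
        have h5 : H v ^ 2 * (1 / m u) < G v := by
          rw [mul_one_div, div_lt_iff₀ hu.2]; nlinarith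
        have h6 : H v ^ 2 * (1 / m v) ≤ H v ^ 2 * (1 / m u) :=
          mul_le_mul_of_nonneg_left (one_div_le_one_div_of_le hu.2 hlt.le) (sq_nonneg _)
        have h7 : H v ^ 2 * (1 / m u + 1 / m v) - 2 * G v < 0 := by rw [mul_add]; linarith
        have := mul_neg_of_pos_of_neg h4 h7
        linarith
      have hxt := mem_of_mem_nhds ht
      filter_upwards [ht, hSo.mem_nhds hxS] with y hy hyS
      rcases le_total y x with h | h
      · exact key y hyS x hxS hy hxt h
      · exact (key x hxS y hyS hxt hy h).symm
    intro b0 hb0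
    by_contra hcon
    push Not at hcon
    set W : ℝ → ℝ := fun x => H x * H x - m x * G x with hW
    have hWc : Continuous W := by fun_prop
    set T : Set ℝ := Icc 0 b0 ∩ {x | 0 ≤ W x} with hT
    have hTc : IsCompact T := isCompact_Icc.inter_right (isClosed_le continuous_const hWc)
    have hTn : T.Nonempty := ⟨0, ⟨le_rfl, hb0.1.le⟩, by simp [hW, hH0, hm0]⟩
    have haT := hTc.sSup_mem hTn
    set a := sSup T with ha
    have hWneg : ∀ x, a < x → x ≤ b0 → W x < 0 := by
      intro x hax hxb
      by_contra h
      push Not at h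
      have : x ≤ a := le_csSup hTc.bddAbove ⟨⟨haT.1.1.trans hax.le, hxb⟩, h⟩
      linarith
    have hmonoW : MonotoneOn W (Icc a b0) := by
      have hder : ∀ x ∈ interior (Icc a b0), HasDerivAt W (H x * m x) x := by
        intro x hx
        rw [interior_Icc] at hx
        have hx0 : 0 < x := haT.1.1.trans_lt hx.1
        have hneg := hWneg x hx.1 hx.2.le
        have hc := hconst x hx0 (by simp only [hW] at hneg; linarith)
        have hm' : HasDerivAt m 0 x := (hasDerivAt_const x (m x)).congr_of_eventuallyEq hc
        have := ((hH x).mul (hH x)).sub (hm'.mul (hG x))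
        refine this.congr_deriv ?_
        ring
      apply monotoneOn_of_deriv_nonneg (convex_Icc a b0) hWc.continuousOn
      · exact fun x hx => (hder x hx).differentiableAt.differentiableWithinAt
      · intro x hx
        rw [(hder x hx).deriv]
        rw [interior_Icc] at hx
        have hx0 : 0 ≤ x := haT.1.1.trans hx.1.le
        exact mul_nonneg (hHn x hx0) (hmn x hx0)
    have h1 := hmonoW ⟨le_rfl, haT.1.2⟩ ⟨haT.1.2, le_rfl⟩ haT.1.2
    have h2 : 0 ≤ W a := haT.2
    have h3 : W b0 < 0 := by simp only [hW]; linarith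
    linarith
  · -- W ≥ 0 implies V monotone
    intro hW u hu v hv huv
    have hVc : ContinuousOn (fun x => - V x) (Icc u v) := by
      intro x hx
      have hx0 : m x ≠ 0 := (hSup u hu x hx.1).2.ne'
      apply ContinuousAt.continuousWithinAt
      apply ContinuousAt.neg
      exact ((continuousAt_const.mul hGc.continuousAt).div hmc.continuousAt hx0).sub
        ((hHc.continuousAt.div hmc.continuousAt hx0).pow 2)
    have := image_le_of_liminf_slope_right_le_deriv_boundary (f := fun x => - V x) (a := u) (b := v)
      (B := fun _ => - V u) (B' := fun _ => 0) hVc le_rfl continuousOn_const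
      (fun x _ => hasDerivWithinAt_const _ _ _) ?_ (x := v) ⟨huv, le_rfl⟩
    · simpa using this
    intro x hx r hr
    apply Filter.Eventually.frequently
    have hxS := hSup u hu x hx.1
    have htend : Filter.Tendsto (fun z => ((H x + H z) * m z - 2 * m x * H x) / m x ^ 2)
        (nhdsWithin x (Ioi x)) (nhds 0) := by
      have hc : Continuous (fun z => ((H x + H z) * m z - 2 * m x * H x) / m x ^ 2) := by
        fun_prop
      have h := (hc.tendsto x).mono_left (nhdsWithin_le_nhds (s := Ioi x))
      convert h using 2
      ring
    filter_upwards [htend.eventually_lt_const hr, self_mem_nhdsWithin] with z hz hxz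
    have hxz' : x < z := hxz
    refine lt_of_le_of_lt ?_ hz
    have hzS := hSup x hxS z hxz'.le
    rw [slope_def_field, div_le_iff₀ (sub_pos.2 hxz')]
    have hDG : H x * (z - x) ≤ G z - G x := by
      apply Convex.mul_sub_le_image_sub_of_le_deriv (convex_Ici x) hGc.continuousOn
        (fun y _ => (hG y).differentiableAt.differentiableWithinAt) _ x self_mem_Ici z hxz'.le hxz'.le
      intro y hy
      rw [interior_Ici] at hy
      rw [(hG y).deriv]
      exact hHmono hxS.1.le (hxS.1.le.trans (le_of_lt hy)) (le_of_lt hy)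
    have hDH : H z - H x ≤ m z * (z - x) := by
      apply Convex.image_sub_le_mul_sub_of_deriv_le (convex_Icc x z) hHc.continuousOn
        (fun y _ => (hH y).differentiableAt.differentiableWithinAt) _ x ⟨le_rfl, hxz'.le⟩ z
        ⟨hxz'.le, le_rfl⟩ hxz'.le
      intro y hy
      rw [interior_Icc] at hy
      rw [(hH y).deriv]
      exact hmm hy.2.le
    have h3 := aux_first (G z) (H z) (m x) (m z) hxS.2 hzS.2
    have h4 : 0 ≤ (m z - m x) / (m x * m z) :=
      div_nonneg (sub_nonneg.2 (hmm hxz'.le)) (mul_pos hxS.2 hzS.2).le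
    have h5 : G z ≤ H z ^ 2 * (1 / m z) := by
      rw [mul_one_div, le_div_iff₀ hzS.2]; nlinarith [hW z hzS]
    have h6 : H z ^ 2 * (1 / m z) ≤ H z ^ 2 * (1 / m x) :=
      mul_le_mul_of_nonneg_left (one_div_le_one_div_of_le hxS.2 (hmm hxz'.le)) (sq_nonneg _)
    have h7 : 0 ≤ H z ^ 2 * (1 / m x + 1 / m z) - 2 * G z := by rw [mul_add]; linarith
    have h8 := mul_nonneg h4 h7
    have h9 : (2 * G x / m x - (H x / m x) ^ 2) - (2 * G z / m x - (H z / m x) ^ 2)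
        = ((H x + H z) * (H z - H x) - 2 * m x * (G z - G x)) / m x ^ 2 := by
      have := hxS.2.ne'
      field_simp
      ring
    have h10 : ((H x + H z) * (H z - H x) - 2 * m x * (G z - G x)) / m x ^ 2 ≤
        ((H x + H z) * m z - 2 * m x * H x) / m x ^ 2 * (z - x) := by
      rw [div_mul_eq_mul_div]
      apply div_le_div_of_nonneg_right _ (sq_nonneg _)
      have e1 := mul_le_mul_of_nonneg_left hDH (add_nonneg (hHp x hxS).le (hHp z hzS).le)
      have e2 := mul_le_mul_of_nonneg_left hDG (mul_nonneg zero_le_two hxS.2.le)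
      linarith
    simp only [hV]
    linarith

/-- Fubini step -/
theorem aux_fubini (μ : Measure ℝ) [IsProbabilityMeasure μ] [NullSingletonClass μ] (b : ℝ) (hb : 0 ≤ b)
    (k : ℝ → ℝ) (hk : Continuous k) :
    ∫ x in Icc 0 b, (∫ t in x..b, k t) ∂μ = ∫ t in (0:ℝ)..b, k t * μ.real (Icc 0 t) := by
  have hkint : IntegrableOn k (Ioc 0 b) volume :=
    (hk.continuousOn.integrableOn_Icc (a := 0) (b := b)).mono_set Ioc_subset_Icc_self
  set f : ℝ → ℝ → ℝ := fun x t => ({p : ℝ × ℝ | p.1 < p.2}).indicator (fun p => k p.2) (x, t)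
    with hf
  have h1 : ∀ x ∈ Icc 0 b, (∫ t in x..b, k t) = ∫ t in Ioc 0 b, f x t := by
    intro x hx
    rw [intervalIntegral.integral_of_le hx.2]
    have e : (fun t => f x t) = (Ioi x).indicator k := by
      ext t
      simp [hf, indicator]
    rw [e, setIntegral_indicator measurableSet_Ioi]
    congr 2
    ext t
    simp only [mem_Ioc, mem_inter_iff, mem_Ioi]
    constructor
    · rintro ⟨h, h'⟩; exact ⟨⟨hx.1.trans_lt h, h'⟩, h⟩
    · rintro ⟨⟨_, h'⟩, h⟩; exact ⟨h, h'⟩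
  have h2 : ∀ t ∈ Ioc 0 b, (∫ x in Icc 0 b, f x t ∂μ) = k t * μ.real (Icc 0 t) := by
    intro t ht
    have e : (fun x => f x t) = (Iio t).indicator (fun _ => k t) := by
      ext x
      simp [hf, indicator]
    rw [e, setIntegral_indicator measurableSet_Iio, setIntegral_const, smul_eq_mul, mul_comm]
    congr 1
    have e2 : Icc 0 b ∩ Iio t = Ico 0 t := by
      ext x
      simp only [mem_Icc, mem_inter_iff, mem_Iio, mem_Ico]
      constructor
      · rintro ⟨⟨h, _⟩, h'⟩; exact ⟨h, h'⟩
      · rintro ⟨h, h'⟩; exact ⟨⟨h, h'.le.trans ht.2⟩, h'⟩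
    rw [e2]
    exact measureReal_congr Ico_ae_eq_Icc
  rw [setIntegral_congr_fun measurableSet_Icc h1, intervalIntegral.integral_of_le hb,
    ← setIntegral_congr_fun measurableSet_Ioc h2]
  apply integral_integral_swap
  have : Integrable (fun p : ℝ × ℝ => k p.2)
      ((μ.restrict (Icc 0 b)).prod (volume.restrict (Ioc 0 b))) := hkint.comp_snd _
  exact this.indicator (measurableSet_lt measurable_fst measurable_snd)

/-- For an absolutely continuous real random variable `X` with
cumulative distribution function `F`, the conditional variance `Var(X | 0 ≤ X ≤ b)`
is increasing in `b > 0` (over `b` with `P(0 ≤ X ≤ b) > 0`) if and only if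
`b ↦ ∬_{0 ≤ x ≤ y ≤ b} (F x - F 0) dx dy` is log-concave in `b` there. -/
theorem conditional_variance_monotone_iff_logConcave
    (μ : Measure ℝ) [IsProbabilityMeasure μ] (hac : μ ≪ volume)
    (F G : ℝ → ℝ)
    (hF : ∀ x, F x = (μ (Iic x)).toReal)
    (hG : ∀ b, G b = ∫ y in (0:ℝ)..b, ∫ x in (0:ℝ)..y, (F x - F 0)) :
    MonotoneOn (fun b => variance id (μ[|Icc 0 b]))
        {b : ℝ | 0 < b ∧ 0 < μ (Icc 0 b)} ↔
      ConcaveOn ℝ {b : ℝ | 0 < b ∧ 0 < μ (Icc 0 b)} (fun b => Real.log (G b)) := by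
  have : NullSingletonClass μ := ⟨fun x => hac (by simp)⟩
  set m : ℝ → ℝ := fun x => F x - F 0 with hm
  set H : ℝ → ℝ := fun y => ∫ x in (0:ℝ)..y, m x with hHdef
  have hFmono : Monotone F := by
    intro x y hxy
    rw [hF, hF]
    exact measureReal_mono (Iic_subset_Iic.2 hxy)
  have hmeq : ∀ x, m x = ∫ _ in (0:ℝ)..x, (1:ℝ) ∂μ := by
    intro x
    rw [intervalIntegral.integral_const_of_cdf]
    simp only [hm, hF, smul_eq_mul, mul_one]
    rfl
  have hmc : Continuous m := by
    have : m = fun x => ∫ _ in (0:ℝ)..x, (1:ℝ) ∂μ := funext hmeq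
    rw [this]
    exact intervalIntegral.continuous_primitive (fun a b => intervalIntegrable_const) 0
  have hmIcc : ∀ x, 0 ≤ x → m x = μ.real (Icc 0 x) := by
    intro x hx
    rw [hmeq, intervalIntegral.integral_of_le hx, setIntegral_const, smul_eq_mul, mul_one]
    exact measureReal_congr Ioc_ae_eq_Icc
  have hH : ∀ x, HasDerivAt H (m x) x := fun x => hmc.integral_hasStrictDerivAt 0 x |>.hasDerivAt
  have hHc : Continuous H := continuous_iff_continuousAt.2 fun x => (hH x).continuousAt
  have hGeq : G = fun b => ∫ y in (0:ℝ)..b, H y := funext hG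
  have hGd : ∀ x, HasDerivAt G (H x) x := fun x => by
    rw [hGeq]; exact hHc.integral_hasStrictDerivAt 0 x |>.hasDerivAt
  have hH0 : H 0 = 0 := by simp [hHdef]
  have hG0 : G 0 = 0 := by simp [hGeq]
  have hSeq : {b : ℝ | 0 < b ∧ 0 < μ (Icc 0 b)} = {b : ℝ | 0 < b ∧ 0 < m b} := by
    ext b
    simp only [mem_ofPred_eq]
    refine and_congr_right fun hb => ?_
    rw [hmIcc b hb.le, measureReal_def, ENNReal.toReal_pos_iff]
    simp [measure_lt_top]
  have hab := aux_abstract m H G hmc (fun x y hxy => sub_le_sub_right (hFmono hxy) _)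
    (by simp [hm]) hH hGd hH0 hG0
  rw [hSeq, ← hab]
  have hvar : EqOn (fun b => variance id (μ[|Icc 0 b]))
      (fun b => 2 * G b / m b - (H b / m b) ^ 2) {b : ℝ | 0 < b ∧ 0 < m b} := by
    intro b hb
    have hb' : b ∈ {b : ℝ | 0 < b ∧ 0 < μ (Icc 0 b)} := by rw [hSeq]; exact hb
    have hprob : IsProbabilityMeasure (μ[|Icc 0 b]) := cond_isProbabilityMeasure hb'.2.ne'
    have hI1 : ∫ x in Icc 0 b, (b - x) ∂μ = H b := by
      have h := aux_fubini μ b hb.1.le (fun _ => 1) continuous_const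
      simp only [intervalIntegral.integral_const, smul_eq_mul, mul_one, one_mul] at h
      rw [h]
      apply intervalIntegral.integral_congr
      intro t ht
      rw [uIcc_of_le hb.1.le] at ht
      exact (hmIcc t ht.1).symm
    have hI2 : ∫ x in Icc 0 b, (b - x) ^ 2 ∂μ = 2 * G b := by
      have h := aux_fubini μ b hb.1.le (fun t => 2 * (b - t)) (by fun_prop)
      have e1 : ∀ x, ∫ t in x..b, 2 * (b - t) = (b - x) ^ 2 := by
        intro x
        have hd : ∀ t ∈ uIcc x b, HasDerivAt (fun t => - (b - t) ^ 2) (2 * (b - t)) t := by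
          intro t _
          have := (((hasDerivAt_id t).const_sub b).pow 2).neg
          refine this.congr_deriv ?_
          norm_num
        rw [intervalIntegral.integral_eq_sub_of_hasDerivAt hd
          (Continuous.intervalIntegrable (by fun_prop) _ _)]
        ring
      simp only [e1] at h
      rw [h]
      have e2 : ∫ t in (0:ℝ)..b, 2 * (b - t) * μ.real (Icc 0 t)
          = ∫ t in (0:ℝ)..b, 2 * (b - t) * m t := by
        apply intervalIntegral.integral_congr
        intro t ht
        rw [uIcc_of_le hb.1.le] at ht
        simp only [hmIcc t ht.1]
      rw [e2]
      have hd : ∀ t ∈ uIcc 0 b, HasDerivAt (fun t => 2 * ((b - t) * H t + G t))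
          (2 * (b - t) * m t) t := by
        intro t _
        have := (((((hasDerivAt_id t).const_sub b).mul (hH t)).add (hGd t)).const_mul 2)
        refine this.congr_deriv ?_
        simp only [id]
        ring
      rw [intervalIntegral.integral_eq_sub_of_hasDerivAt hd
        (Continuous.intervalIntegrable (by fun_prop) _ _)]
      rw [hH0, hG0]; ring
    have hcond : ∀ g : ℝ → ℝ, ∫ x, g x ∂(μ[|Icc 0 b]) = (∫ x in Icc 0 b, g x ∂μ) / m b := by
      intro g
      rw [ProbabilityTheory.cond, integral_smul_measure, hmIcc b hb.1.le, smul_eq_mul,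
        ENNReal.toReal_inv, measureReal_def, div_eq_inv_mul]
    have hv1 : variance id (μ[|Icc 0 b]) = variance (fun x => b - x) (μ[|Icc 0 b]) :=
      (variance_const_sub (X := id) aestronglyMeasurable_id b).symm
    have hL2 : MemLp (fun x : ℝ => b - x) 2 (μ[|Icc 0 b]) := by
      apply MemLp.of_bound (by fun_prop) b
      filter_upwards [ae_cond_mem (μ := μ) (measurableSet_Icc (a := 0) (b := b))] with x hx
      rw [Real.norm_eq_abs, abs_le]
      constructor <;> linarith [hx.1, hx.2]
    show variance id (μ[|Icc 0 b]) = _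
    rw [hv1, variance_eq_sub hL2]
    have e3 := hcond (fun x => (b - x) ^ 2)
    have e4 := hcond (fun x => b - x)
    rw [hI2] at e3
    rw [hI1] at e4
    rw [e4]
    exact congrArg (fun z => z - (H b / m b) ^ 2) e3
  exact ⟨fun h => h.congr hvar, fun h => h.congr hvar.symm⟩
end

section
/- Let X be an absolutely continuous real random variable with cumulative distribution function F, and fix a real number a. Then the conditional variance Var(X | a ≤ X ≤ b) is increasing in b (over b > a with P(a ≤ X ≤ b) > 0) if and only if the function b ↦ ∫∫_{a ≤ x ≤ y ≤ b} (F(x) − F(a)) dx dy is log-concave in b. -/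
open MeasureTheory ProbabilityTheory Set


theorem cv_sandwich {g H G : ℝ → ℝ} {a : ℝ} (hgm : Monotone g)
    (hH : ∀ x, HasDerivAt H (g x) x) (hG : ∀ x, HasDerivAt G (H x) x)
    (hH0 : ∀ x, a ≤ x → 0 ≤ H x) {x y : ℝ} (hax : a ≤ x) (hxy : x ≤ y) :
    2 * g x * (G y - G x) ≤ H y ^ 2 - H x ^ 2 ∧ H y ^ 2 - H x ^ 2 ≤ 2 * g y * (G y - G x) := by
  have hd : ∀ k t, HasDerivAt (fun t => H t ^ 2 - 2 * k * G t) (2 * H t * (g t - k)) t := by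
    intro k t
    have := ((hH t).pow 2).sub ((hG t).const_mul (2 * k))
    refine this.congr_deriv ?_
    push_cast
    ring
  have hc : ∀ k, ContinuousOn (fun t => H t ^ 2 - 2 * k * G t) (Icc x y) :=
    fun k t _ => (hd k t).continuousAt.continuousWithinAt
  constructor
  · have := monotoneOn_of_deriv_nonneg (convex_Icc x y) (hc (g x))
      (fun t _ => (hd (g x) t).differentiableAt.differentiableWithinAt) (by
        intro t ht
        rw [interior_Icc] at ht
        rw [(hd (g x) t).deriv]
        have := hH0 t (hax.trans ht.1.le)
        have := hgm ht.1.le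
        exact mul_nonneg (by linarith) (by linarith))
    have := this (left_mem_Icc.2 hxy) (right_mem_Icc.2 hxy) hxy
    simp only at this
    linarith
  · have := antitoneOn_of_deriv_nonpos (convex_Icc x y) (hc (g y))
      (fun t _ => (hd (g y) t).differentiableAt.differentiableWithinAt) (by
        intro t ht
        rw [interior_Icc] at ht
        rw [(hd (g y) t).deriv]
        have := hH0 t (hax.trans ht.1.le)
        have := hgm ht.2.le
        exact mul_nonpos_of_nonneg_of_nonpos (by linarith) (by linarith))
    have := this (left_mem_Icc.2 hxy) (right_mem_Icc.2 hxy) hxy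
    simp only at this
    linarith

theorem cv_real {g H G : ℝ → ℝ} {a : ℝ} (hgc : Continuous g) (hgm : Monotone g)
    (hga : g a = 0) (hHa : H a = 0) (hGa : G a = 0)
    (hH : ∀ x, HasDerivAt H (g x) x) (hG : ∀ x, HasDerivAt G (H x) x) :
    MonotoneOn (fun b => 2 * G b / g b - (H b / g b) ^ 2) {b | 0 < g b} ↔
      ConcaveOn ℝ {b | 0 < g b} (fun b => Real.log (G b)) := by
  have hHc : Continuous H := continuous_iff_continuousAt.2 fun x => (hH x).continuousAt
  have hGc : Continuous G := continuous_iff_continuousAt.2 fun x => (hG x).continuousAt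
  have hSa : ∀ b, 0 < g b → a < b := fun b hb => by
    by_contra! h
    have := hgm h
    linarith
  have hSo : IsOpen {b | 0 < g b} := isOpen_lt continuous_const hgc
  have hSc : Convex ℝ {b | 0 < g b} := by
    refine OrdConnected.convex ⟨fun x hx y hy z hz => ?_⟩
    exact lt_of_lt_of_le hx (hgm hz.1)
  have hg0 : ∀ x, a ≤ x → 0 ≤ g x := fun x hx => hga ▸ hgm hx
  have hHm : MonotoneOn H (Ici a) := monotoneOn_of_deriv_nonneg (convex_Ici a) hHc.continuousOn
    (fun t _ => (hH t).differentiableAt.differentiableWithinAt) (by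
      intro t ht
      rw [interior_Ici] at ht
      rw [(hH t).deriv]
      exact hg0 t (le_of_lt ht))
  have hH0 : ∀ x, a ≤ x → 0 ≤ H x := fun x hx => hHa ▸ hHm self_mem_Ici hx hx
  have hGm : MonotoneOn G (Ici a) := monotoneOn_of_deriv_nonneg (convex_Ici a) hGc.continuousOn
    (fun t _ => (hG t).differentiableAt.differentiableWithinAt) (by
      intro t ht
      rw [interior_Ici] at ht
      rw [(hG t).deriv]
      exact hH0 t (le_of_lt ht))
  have hG0 : ∀ x, a ≤ x → 0 ≤ G x := fun x hx => hGa ▸ hGm self_mem_Ici hx hx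
  -- points of S slightly to the left
  have hleft : ∀ b, 0 < g b → ∃ c, c < b ∧ 0 < g c := by
    intro b hb
    have h1 : ∀ᶠ c in nhdsWithin b (Iio b), 0 < g c :=
      Filter.Eventually.filter_mono nhdsWithin_le_nhds (hSo.mem_nhds hb)
    have h2 : ∀ᶠ c in nhdsWithin b (Iio b), c < b := self_mem_nhdsWithin
    obtain ⟨c, hc⟩ := (h1.and h2).exists
    exact ⟨c, hc.2, hc.1⟩
  have hHp : ∀ b, 0 < g b → 0 < H b := by
    intro b hb
    obtain ⟨c, hcb, hc⟩ := hleft b hb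
    obtain ⟨t, ht, hs⟩ := exists_hasDerivAt_eq_slope H g hcb hHc.continuousOn (fun x _ => hH x)
    have h1 : 0 < g t := hc.trans_le (hgm ht.1.le)
    rw [hs] at h1
    have h2 : 0 < H b - H c := (div_pos_iff_of_pos_right (by linarith)).1 h1
    linarith [hH0 c (hSa c hc).le]
  have hGp : ∀ b, 0 < g b → 0 < G b := by
    intro b hb
    obtain ⟨c, hcb, hc⟩ := hleft b hb
    obtain ⟨t, ht, hs⟩ := exists_hasDerivAt_eq_slope G H hcb hGc.continuousOn (fun x _ => hG x)
    have h1 : 0 < H t := hHp t (hc.trans_le (hgm ht.1.le))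
    rw [hs] at h1
    have h2 : 0 < G b - G c := (div_pos_iff_of_pos_right (by linarith)).1 h1
    linarith [hG0 c (hSa c hc).le]
  have key : ConcaveOn ℝ {b | 0 < g b} (fun b => Real.log (G b)) ↔
      ∀ b, 0 < g b → G b * g b ≤ H b ^ 2 := by
    have hL : ∀ b, 0 < g b → HasDerivAt (fun b => Real.log (G b)) (H b / G b) b :=
      fun b hb => (hG b).log (hGp b hb).ne'
    have hR : ∀ b, 0 < g b → HasDerivAt (fun b => H b / G b)
        ((g b * G b - H b * H b) / G b ^ 2) b :=
      fun b hb => (hH b).div (hG b) (hGp b hb).ne'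
    constructor
    · intro h b hb
      have h1 := h.antitoneOn_deriv (fun x hx => (hL x hx).differentiableAt)
      have h2 : AntitoneOn (fun b => H b / G b) {b | 0 < g b} :=
        h1.congr (fun x hx => (hL x hx).deriv)
      have h3 := h2.derivWithin_nonpos (x := b)
      rw [derivWithin_of_mem_nhds (hSo.mem_nhds hb), (hR b hb).deriv] at h3
      have h4 : 0 < G b ^ 2 := pow_pos (hGp b hb) 2
      by_contra! h5
      have : 0 < (g b * G b - H b * H b) / G b ^ 2 := div_pos (by nlinarith) h4
      linarith
    · intro h
      have h2 : AntitoneOn (fun b => H b / G b) {b | 0 < g b} := by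
        refine antitoneOn_of_deriv_nonpos hSc
          (fun t ht => (hR t ht).continuousAt.continuousWithinAt) ?_ ?_
        · rw [hSo.interior_eq]
          exact fun t ht => (hR t ht).differentiableAt.differentiableWithinAt
        · rw [hSo.interior_eq]
          intro t ht
          rw [(hR t ht).deriv]
          exact div_nonpos_of_nonpos_of_nonneg (by nlinarith [h t ht]) (by positivity)
      refine AntitoneOn.concaveOn_of_deriv hSc
          (fun t ht => (hL t ht).continuousAt.continuousWithinAt) ?_ ?_
      · rw [hSo.interior_eq]
        exact fun t ht => (hL t ht).differentiableAt.differentiableWithinAt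
      · rw [hSo.interior_eq]
        exact h2.congr (fun x hx => (hL x hx).deriv.symm)
  rw [key]
  clear key
  have sand := fun {x y : ℝ} => cv_sandwich (x := x) (y := y) hgm hH hG hH0
  constructor
  · intro hV p hp
    by_contra! hD
    -- leftmost point of the level set
    have hcl : IsClosed {t | g t = g p} := isClosed_eq hgc continuous_const
    have hbd : BddBelow {t | g t = g p} := ⟨a, fun t ht => (hSa t (by rw [ht]; exact hp)).le⟩
    obtain ⟨q, hq⟩ : ∃ q, q = sInf {t | g t = g p} := ⟨_, rfl⟩
    have hqg : g q = g p := hq ▸ hcl.csInf_mem ⟨p, rfl⟩ hbd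
    have hqp : q ≤ p := hq ▸ csInf_le hbd rfl
    have hql : ∀ t, t < q → g t < g q := by
      intro t ht
      refine lt_of_le_of_ne (hgm ht.le) fun h => ?_
      have : q ≤ t := hq ▸ csInf_le hbd (h.trans hqg)
      linarith
    have hqS : 0 < g q := hqg ▸ hp
    have haq := hSa q hqS
    have hDq : H q ^ 2 - G q * g q < 0 := by
      have h1 := (sand haq.le hqp).1
      have h2 : G q ≤ G p := hGm haq.le (haq.le.trans hqp) hqp
      rw [hqg] at h1 ⊢
      nlinarith
    have hlim : Filter.Tendsto (fun t => H q ^ 2 * (1 / g t + 1 / g q) - 2 * G q)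
        (nhdsWithin q (Iio q)) (nhds (H q ^ 2 * (1 / g q + 1 / g q) - 2 * G q)) := by
      refine ContinuousAt.continuousWithinAt (f := fun t => H q ^ 2 * (1 / g t + 1 / g q) - 2 * G q) ?_
      have := hgc.continuousAt (x := q)
      fun_prop (disch := exact hqS.ne')
    have hneg : H q ^ 2 * (1 / g q + 1 / g q) - 2 * G q < 0 := by
      have : H q ^ 2 * (1 / g q + 1 / g q) - 2 * G q = 2 * (H q ^ 2 - G q * g q) / g q := by
        field_simp
        ring
      rw [this]
      exact div_neg_of_neg_of_pos (by linarith) hqS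
    have e1 : ∀ᶠ c in nhdsWithin q (Iio q), 0 < g c :=
      Filter.Eventually.filter_mono nhdsWithin_le_nhds (hSo.mem_nhds hqS)
    have e2 : ∀ᶠ c in nhdsWithin q (Iio q), c < q := self_mem_nhdsWithin
    have hev := (hlim.eventually (gt_mem_nhds hneg)).and (e1.and e2)
    obtain ⟨t, h1, h2, h3⟩ := hev.exists
    have hVt := hV h2 hqS h3.le
    simp only at hVt
    have h4 := (sand (hSa t h2).le h3.le).1
    have h5 := hql t h3
    have h6 : 1 / g q < 1 / g t := one_div_lt_one_div_of_lt h2 h5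
    have h7 : (2 * G q / g q - (H q / g q) ^ 2) - (2 * G t / g t - (H t / g t) ^ 2)
      = (1 / g t - 1 / g q) * (H q ^ 2 * (1 / g t + 1 / g q) - 2 * G q)
        - ((H q ^ 2 - H t ^ 2) - 2 * g t * (G q - G t)) / g t ^ 2 := by
      field_simp
      ring
    have h8 : 0 ≤ ((H q ^ 2 - H t ^ 2) - 2 * g t * (G q - G t)) / g t ^ 2 :=
      div_nonneg (by linarith) (by positivity)
    have h9 := mul_neg_of_pos_of_neg (sub_pos.2 h6) h1
    linarith
  · intro hD p hp r hr hpr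
    have hloc : ∀ ε > 0, 2 * G p / g p - (H p / g p) ^ 2 + ε * g p
        ≤ 2 * G r / g r - (H r / g r) ^ 2 + ε * g r := by
      intro ε hε
      have hgI : ∀ t ∈ Icc p r, 0 < g t := fun t ht => lt_of_lt_of_le hp (hgm ht.1)
      have hsub : Icc p r ⊆ {t | 2 * G p / g p - (H p / g p) ^ 2 + ε * g p
          ≤ 2 * G t / g t - (H t / g t) ^ 2 + ε * g t} := by
        refine IsClosed.Icc_subset_of_forall_mem_nhdsWithin ?_ ?_ ?_
        · have hcont : ContinuousOn (fun t => 2 * G t / g t - (H t / g t) ^ 2 + ε * g t)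
              (Icc p r) := by
            have h1 := hgc.continuousOn (s := Icc p r)
            have h2 := hGc.continuousOn (s := Icc p r)
            have h3 := hHc.continuousOn (s := Icc p r)
            have h4 : ∀ x ∈ Icc p r, g x ≠ 0 := fun x hx => (hgI x hx).ne'
            fun_prop (disch := assumption)
          have := hcont.preimage_isClosed_of_isClosed isClosed_Icc (isClosed_Ici
            (a := 2 * G p / g p - (H p / g p) ^ 2 + ε * g p))
          rw [inter_comm]
          exact this
        · simp
        · rintro t ⟨ht, htI⟩
          have htg := hgI t ⟨htI.1, htI.2.le⟩
          have hat := hSa t htg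
          have hlim : Filter.Tendsto (fun b => (H b ^ 2 * (1 / g t + 1 / g b) - 2 * G b)
              * (1 / g t) * (1 / g b) - 2 * (G b - G t) / g t ^ 2)
              (nhdsWithin t (Ioi t)) (nhds ((H t ^ 2 * (1 / g t + 1 / g t) - 2 * G t)
              * (1 / g t) * (1 / g t) - 2 * (G t - G t) / g t ^ 2)) := by
            refine ContinuousAt.continuousWithinAt (f := fun b =>
              (H b ^ 2 * (1 / g t + 1 / g b) - 2 * G b)
              * (1 / g t) * (1 / g b) - 2 * (G b - G t) / g t ^ 2) ?_
            have := hgc.continuousAt (x := t)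
            fun_prop (disch := positivity)
          have hpos : -ε < (H t ^ 2 * (1 / g t + 1 / g t) - 2 * G t)
              * (1 / g t) * (1 / g t) - 2 * (G t - G t) / g t ^ 2 := by
            have : (H t ^ 2 * (1 / g t + 1 / g t) - 2 * G t)
              * (1 / g t) * (1 / g t) - 2 * (G t - G t) / g t ^ 2
              = 2 * (H t ^ 2 - G t * g t) / g t ^ 3 := by
              field_simp
              ring
            rw [this]
            have := div_nonneg (a := 2 * (H t ^ 2 - G t * g t)) (b := g t ^ 3)
              (by linarith [hD t htg]) (by positivity)
            linarith
          filter_upwards [hlim.eventually (lt_mem_nhds hpos), self_mem_nhdsWithin] with b h1 h2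
          have h2' : t < b := h2
          have hbg : 0 < g b := htg.trans_le (hgm h2'.le)
          simp only [mem_ofPred_eq] at ht ⊢
          refine ht.trans ?_
          have h4 := (sand hat.le h2'.le).2
          have h5 : g t ≤ g b := hgm h2'.le
          have h7 : (2 * G b / g b - (H b / g b) ^ 2) - (2 * G t / g t - (H t / g t) ^ 2)
            = (g b - g t) * ((H b ^ 2 * (1 / g t + 1 / g b) - 2 * G b)
              * (1 / g t) * (1 / g b) - 2 * (G b - G t) / g t ^ 2)
              + (2 * g b * (G b - G t) - (H b ^ 2 - H t ^ 2)) / g t ^ 2 := by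
            field_simp
            ring
          have h8 : 0 ≤ (2 * g b * (G b - G t) - (H b ^ 2 - H t ^ 2)) / g t ^ 2 :=
            div_nonneg (by linarith) (by positivity)
          have h9 := mul_le_mul_of_nonneg_left h1.le (sub_nonneg.2 h5)
          linarith
      exact hsub (right_mem_Icc.2 hpr)
    have hgpr : g p ≤ g r := hgm hpr
    refine le_of_forall_pos_le_add fun ε hε => ?_
    have h1 := hloc (ε / (g r - g p + 1)) (by apply div_pos hε; linarith)
    have h2 : ε / (g r - g p + 1) * (g r - g p) ≤ ε := by
      rw [div_mul_eq_mul_div, div_le_iff₀ (by linarith)]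
      nlinarith
    simp only
    linarith

theorem cv_cont (μ : Measure ℝ) [IsProbabilityMeasure μ] (hac : μ ≪ volume) :
    Continuous (cdf μ) := by
  rw [continuous_iff_continuousAt]
  intro x
  rw [(monotone_cdf μ).continuousAt_iff_leftLim_eq_rightLim, StieltjesFunction.rightLim_eq]
  have h1 := (cdf μ).measure_singleton x
  rw [measure_cdf, hac (by simp)] at h1
  have h2 : cdf μ x - Function.leftLim (cdf μ) x ≤ 0 := ENNReal.ofReal_eq_zero.1 h1.symm
  exact le_antisymm ((monotone_cdf μ).leftLim_le le_rfl) (by linarith)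

theorem cv_fubini (μ : Measure ℝ) [IsProbabilityMeasure μ] {a b : ℝ} (hab : a ≤ b)
    (k : ℝ × ℝ → ℝ) (hk : Continuous k) :
    ∫ x in Ioc a b, (∫ y in x..b, k (x, y)) ∂μ = ∫ y in a..b, (∫ x in Ioc a y, k (x, y) ∂μ) := by
  obtain ⟨C, hC⟩ := (isCompact_Icc (a := a) (b := b) |>.prod (isCompact_Icc (a := a) (b := b))
    ).exists_bound_of_continuousOn hk.continuousOn
  have hint : Integrable (Function.uncurry fun x y => (Ici x).indicator (fun y => k (x, y)) y)
      ((μ.restrict (Ioc a b)).prod (volume.restrict (Ioc a b))) := by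
    have hset : MeasurableSet {p : ℝ × ℝ | p.1 ≤ p.2} := measurableSet_le measurable_fst measurable_snd
    have heq : (Function.uncurry fun x y => (Ici x).indicator (fun y => k (x, y)) y)
        = {p : ℝ × ℝ | p.1 ≤ p.2}.indicator k := by
      ext ⟨x, y⟩
      simp [Function.uncurry, indicator]
    rw [heq]
    refine Integrable.indicator ?_ hset
    rw [Measure.prod_restrict]
    refine Measure.integrableOn_of_bounded (M := C) ?_ hk.aestronglyMeasurable ?_
    · rw [Measure.prod_prod]
      exact ENNReal.mul_ne_top (measure_ne_top _ _) (by simp)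
    · refine (ae_restrict_iff' (measurableSet_Ioc.prod measurableSet_Ioc)).2 (ae_of_all _ ?_)
      rintro ⟨x, y⟩ ⟨hx, hy⟩
      exact hC _ ⟨Ioc_subset_Icc_self hx, Ioc_subset_Icc_self hy⟩
  have hsw := integral_integral_swap hint
  rw [intervalIntegral.integral_of_le hab]
  calc _ = _ := ?_
    _ = _ := hsw
    _ = _ := ?_
  · refine setIntegral_congr_fun measurableSet_Ioc fun x hx => ?_
    rw [setIntegral_indicator measurableSet_Ici, intervalIntegral.integral_of_le hx.2,
      ← integral_Icc_eq_integral_Ioc]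
    congr 2
    ext y
    simp only [mem_Icc, mem_inter_iff, mem_Ioc, mem_Ici]
    constructor
    · rintro ⟨h1, h2⟩; exact ⟨⟨lt_of_lt_of_le hx.1 h1, h2⟩, h1⟩
    · rintro ⟨⟨_, h2⟩, h3⟩; exact ⟨h3, h2⟩
  · refine setIntegral_congr_fun measurableSet_Ioc fun y hy => ?_
    have : (fun x => (Ici x).indicator (fun y => k (x, y)) y)
        = (Iic y).indicator (fun x => k (x, y)) := by
      ext x
      simp [indicator]
    rw [this, setIntegral_indicator measurableSet_Iic]
    congr 2
    ext x
    simp only [mem_inter_iff, mem_Ioc, mem_Iic]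
    constructor
    · rintro ⟨⟨h1, _⟩, h3⟩; exact ⟨h1, h3⟩
    · rintro ⟨h1, h2⟩; exact ⟨⟨h1, h2.trans hy.2⟩, h2⟩

theorem cv_mom1 (μ : Measure ℝ) [IsProbabilityMeasure μ] {a b : ℝ} (hab : a ≤ b) :
    ∫ x in Ioc a b, (b - x) ∂μ = ∫ y in a..b, (cdf μ y - cdf μ a) := by
  have h := cv_fubini μ hab (fun _ => 1) continuous_const
  simp only [intervalIntegral.integral_const, smul_eq_mul, mul_one] at h
  rw [h]
  refine intervalIntegral.integral_congr fun y hy => ?_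
  rw [uIcc_of_le hab] at hy
  simp only [integral_const, smul_eq_mul, mul_one, measureReal_restrict_apply_univ]
  rw [cdf_eq_real, cdf_eq_real, ← Iic_sdiff_Iic, measureReal_sdiff (Iic_subset_Iic.2 hy.1) measurableSet_Iic]

theorem cv_mom2 (μ : Measure ℝ) [IsProbabilityMeasure μ] {a b : ℝ} (hab : a ≤ b) :
    ∫ x in Ioc a b, (b - x) ^ 2 ∂μ = 2 * ∫ y in a..b, ∫ x in a..y, (cdf μ x - cdf μ a) := by
  have h := cv_fubini μ hab (fun p => 2 * (p.2 - p.1)) (by fun_prop)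
  have h1 : ∀ x, ∫ y in x..b, 2 * (y - x) = (b - x) ^ 2 := by
    intro x
    simp
    ring
  simp only [h1] at h
  rw [h, ← intervalIntegral.integral_const_mul]
  refine intervalIntegral.integral_congr fun y hy => ?_
  rw [uIcc_of_le hab] at hy
  rw [integral_const_mul, cv_mom1 μ hy.1]

theorem cv_var (μ : Measure ℝ) [IsProbabilityMeasure μ] (hac : μ ≪ volume) {a b : ℝ} (hab : a ≤ b)
    (hpos : μ (Icc a b) ≠ 0) (hg : μ.real (Icc a b) = cdf μ b - cdf μ a) :
    variance id (μ[|Icc a b]) =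
      2 * (∫ y in a..b, ∫ x in a..y, (cdf μ x - cdf μ a)) / (cdf μ b - cdf μ a)
      - ((∫ y in a..b, (cdf μ y - cdf μ a)) / (cdf μ b - cdf μ a)) ^ 2 := by
  have : NullSingletonClass μ := ⟨fun x => hac (by simp)⟩
  have : IsProbabilityMeasure (μ[|Icc a b]) := cond_isProbabilityMeasure hpos
  have hm : ∀ᵐ x ∂(μ[|Icc a b]), x ∈ Icc a b := ae_cond_mem measurableSet_Icc
  have hI : ∀ f : ℝ → ℝ, ∫ x, f x ∂(μ[|Icc a b]) = (∫ x in Ioc a b, f x ∂μ) / (cdf μ b - cdf μ a) := by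
    intro f
    rw [ProbabilityTheory.cond, integral_smul_measure, integral_Icc_eq_integral_Ioc, ← hg]
    simp [Measure.real, div_eq_inv_mul]
  rw [← variance_const_sub (by fun_prop) b, variance_eq_sub]
  · rw [← cv_mom1 μ hab, ← cv_mom2 μ hab, ← hI, ← hI]
    simp
  · refine memLp_of_bounded (a := 0) (b := b - a) ?_ (by fun_prop) 2
    filter_upwards [hm] with x hx
    simp only [id, mem_Icc] at hx ⊢
    constructor <;> linarith

/-- For an absolutely continuous real random variable `X` with
cumulative distribution function `F`, and fixed `a`, the conditional variance
`Var(X | a ≤ X ≤ b)` is increasing in `b` (over `b > a` with `P(a ≤ X ≤ b) > 0`)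
if and only if `b ↦ ∬_{a ≤ x ≤ y ≤ b} (F x - F a) dx dy` is log-concave in `b` there. -/
theorem conditional_variance_monotone_in_b_iff_logConcave
    (μ : Measure ℝ) [IsProbabilityMeasure μ] (hac : μ ≪ volume)
    (a : ℝ) (F G : ℝ → ℝ)
    (hF : ∀ x, F x = (μ (Iic x)).toReal)
    (hG : ∀ b, G b = ∫ y in a..b, ∫ x in a..y, (F x - F a)) :
    MonotoneOn (fun b => variance id (μ[|Icc a b]))
        {b : ℝ | a < b ∧ 0 < μ (Icc a b)} ↔
      ConcaveOn ℝ {b : ℝ | a < b ∧ 0 < μ (Icc a b)} (fun b => Real.log (G b)) := by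
  have hatom : NullSingletonClass μ := ⟨fun x => hac (by simp)⟩
  obtain rfl : F = fun x => cdf μ x := by
    ext x
    rw [hF, cdf_eq_real]
    rfl
  obtain rfl : G = fun b => ∫ y in a..b, ∫ x in a..y, (cdf μ x - cdf μ a) := funext hG
  have hc := cv_cont μ hac
  have hg : ∀ b, a ≤ b → μ.real (Icc a b) = cdf μ b - cdf μ a := by
    intro b hab
    rw [cdf_eq_real, cdf_eq_real, ← measureReal_sdiff (Iic_subset_Iic.2 hab) measurableSet_Iic,
      Iic_sdiff_Iic, measureReal_def, measureReal_def, measure_congr Ioc_ae_eq_Icc]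
  have hS : {b : ℝ | a < b ∧ 0 < μ (Icc a b)} = {b | 0 < cdf μ b - cdf μ a} := by
    ext b
    simp only [mem_ofPred_eq]
    constructor
    · rintro ⟨h1, h2⟩
      rw [← hg b h1.le]
      exact ENNReal.toReal_pos h2.ne' (measure_ne_top _ _)
    · intro h
      have hab : a < b := by
        by_contra! h'
        have := monotone_cdf μ h'
        linarith
      rw [← hg b hab.le] at h
      exact ⟨hab, (ENNReal.toReal_pos_iff.1 h).1⟩
  have hgc : Continuous fun b => cdf μ b - cdf μ a := hc.sub continuous_const
  have hH : ∀ x, HasDerivAt (fun b => ∫ y in a..b, (cdf μ y - cdf μ a)) (cdf μ x - cdf μ a) x :=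
    fun x => intervalIntegral.integral_hasDerivAt_right (hgc.intervalIntegrable _ _)
      (hgc.stronglyMeasurableAtFilter _ _) hgc.continuousAt
  have hHc : Continuous fun b => ∫ y in a..b, (cdf μ y - cdf μ a) :=
    continuous_iff_continuousAt.2 fun x => (hH x).continuousAt
  have hGd : ∀ x, HasDerivAt (fun b => ∫ y in a..b, ∫ x in a..y, (cdf μ x - cdf μ a))
      (∫ y in a..x, (cdf μ y - cdf μ a)) x :=
    fun x => intervalIntegral.integral_hasDerivAt_right (hHc.intervalIntegrable _ _)
      (hHc.stronglyMeasurableAtFilter _ _) hHc.continuousAt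
  have main := cv_real (a := a) hgc (fun x y h => sub_le_sub_right (monotone_cdf μ h) _)
    (by simp) (by simp) (by simp) hH hGd
  have hV : EqOn (fun b => variance id (μ[|Icc a b])) (fun b =>
      2 * (∫ y in a..b, ∫ x in a..y, (cdf μ x - cdf μ a)) / (cdf μ b - cdf μ a)
      - ((∫ y in a..b, (cdf μ y - cdf μ a)) / (cdf μ b - cdf μ a)) ^ 2)
      {b : ℝ | a < b ∧ 0 < μ (Icc a b)} :=
    fun b hb => cv_var μ hac hb.1.le hb.2.ne' (hg b hb.1.le)
  rw [← hS] at main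
  exact ⟨fun h => main.1 (h.congr hV), fun h => (main.2 h).congr hV.symm⟩
end
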